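/- arXiv:1506.01605 — 9 statements merged into one kernel-verified Lean document; each statement's English description precedes it below -/
import Mathlib

section
/- Let Ω ⊆ ℝ² be open, let g : Ω → ℝ³ be a smooth immersion, let N := (g_x × g_y)/‖g_x × g_y‖ be its unit normal, and suppose there is a real constant H₁ ≠ 0 such that the mean curvature of g with respect to N equals H₁ at every point of Ω. Let K₁ : Ω → ℝ be the Gauss curvature of g with respect to N and define the parallel map f := g + (1/(2H₁))·N. Then on Ω one has ⟨f_x, N⟩ = ⟨f_y, N⟩ = 0, the identity f_x × f_y = (K₁/(4H₁²))·(g_x × g_y) holds, and f is an immersion at a point p if and only if K₁(p) ≠ 0. -/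
noncomputable section

open Real

/-- Euclidean dot product on `ℝ³`. -/
def dot3 (u v : Fin 3 → ℝ) : ℝ := u 0 * v 0 + u 1 * v 1 + u 2 * v 2

/-- Cross product on `ℝ³`. -/
def cross3 (u v : Fin 3 → ℝ) : Fin 3 → ℝ :=
  ![u 1 * v 2 - u 2 * v 1, u 2 * v 0 - u 0 * v 2, u 0 * v 1 - u 1 * v 0]

/-- Euclidean norm on `ℝ³`. -/
def norm3 (u : Fin 3 → ℝ) : ℝ := Real.sqrt (dot3 u u)

/-- Partial derivative in the first (x) coordinate direction. -/
def px (f : ℝ × ℝ → Fin 3 → ℝ) (p : ℝ × ℝ) : Fin 3 → ℝ := fderiv ℝ f p (1, 0)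

/-- Partial derivative in the second (y) coordinate direction. -/
def py (f : ℝ × ℝ → Fin 3 → ℝ) (p : ℝ × ℝ) : Fin 3 → ℝ := fderiv ℝ f p (0, 1)

/-- Gauss curvature of `g` with respect to the unit normal field `ν`:
`K = (l·n − m²)/(E·G − F²)`. -/
def GaussK (g ν : ℝ × ℝ → Fin 3 → ℝ) (p : ℝ × ℝ) : ℝ :=
  (dot3 (px (px g) p) (ν p) * dot3 (py (py g) p) (ν p) - dot3 (py (px g) p) (ν p) ^ 2) /
    (dot3 (px g p) (px g p) * dot3 (py g p) (py g p) - dot3 (px g p) (py g p) ^ 2)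

/-- Mean curvature of `g` with respect to the unit normal field `ν`:
`H = (E·n − 2F·m + G·l)/(2(E·G − F²))`. -/
def MeanH (g ν : ℝ × ℝ → Fin 3 → ℝ) (p : ℝ × ℝ) : ℝ :=
  (dot3 (px g p) (px g p) * dot3 (py (py g) p) (ν p)
      - 2 * dot3 (px g p) (py g p) * dot3 (py (px g) p) (ν p)
      + dot3 (py g p) (py g p) * dot3 (px (px g) p) (ν p)) /
    (2 * (dot3 (px g p) (px g p) * dot3 (py g p) (py g p) - dot3 (px g p) (py g p) ^ 2))

theorem fderiv_dot3_apply {u v : ℝ × ℝ → Fin 3 → ℝ} {p : ℝ × ℝ} (hu : DifferentiableAt ℝ u p)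
    (hv : DifferentiableAt ℝ v p) (w : ℝ × ℝ) :
    fderiv ℝ (fun q => dot3 (u q) (v q)) p w
      = dot3 (fderiv ℝ u p w) (v p) + dot3 (u p) (fderiv ℝ v p w) := by
  have hu' := hasFDerivAt_pi'.1 hu.hasFDerivAt
  have hv' := hasFDerivAt_pi'.1 hv.hasFDerivAt
  have h := (((hu' 0).mul (hv' 0)).add ((hu' 1).mul (hv' 1))).add ((hu' 2).mul (hv' 2))
  have h' : HasFDerivAt (fun q => dot3 (u q) (v q)) _ p := h
  rw [h'.fderiv]
  simp [dot3]
  ring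

theorem dot3_fderiv_add_eq_zero {u v : ℝ × ℝ → Fin 3 → ℝ} {p : ℝ × ℝ} {c : ℝ}
    (hu : DifferentiableAt ℝ u p) (hv : DifferentiableAt ℝ v p)
    (h : ∀ᶠ q in nhds p, dot3 (u q) (v q) = c) (w : ℝ × ℝ) :
    dot3 (fderiv ℝ u p w) (v p) + dot3 (u p) (fderiv ℝ v p w) = 0 := by
  have h' : (fun q => dot3 (u q) (v q)) =ᶠ[nhds p] fun _ => c := h
  rw [← fderiv_dot3_apply hu hv, h'.fderiv_eq]
  simp

theorem dot3_self_pos {u : Fin 3 → ℝ} (hu : u ≠ 0) : 0 < dot3 u u := by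
  refine lt_of_le_of_ne
    (by unfold dot3; nlinarith [sq_nonneg (u 0), sq_nonneg (u 1), sq_nonneg (u 2)]) fun h => hu ?_
  unfold dot3 at h
  ext i
  fin_cases i <;> simp <;> nlinarith [sq_nonneg (u 0), sq_nonneg (u 1), sq_nonneg (u 2)]

theorem dot3_add_smul_left (u w v : Fin 3 → ℝ) (c : ℝ) :
    dot3 (u + c • w) v = dot3 u v + c * dot3 w v := by
  simp [dot3]
  ring

theorem dot3_smul_right (u v : Fin 3 → ℝ) (c : ℝ) : dot3 u (c • v) = c * dot3 u v := by
  simp [dot3]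
  ring

theorem dot3_smul_left (u v : Fin 3 → ℝ) (c : ℝ) : dot3 (c • u) v = c * dot3 u v := by
  simp [dot3]
  ring

theorem dot3_comm (u v : Fin 3 → ℝ) : dot3 u v = dot3 v u := by
  simp [dot3, mul_comm]

theorem dot3_cross3_left (u v : Fin 3 → ℝ) : dot3 u (cross3 u v) = 0 := by
  simp [dot3, cross3]
  ring

theorem dot3_cross3_right (u v : Fin 3 → ℝ) : dot3 v (cross3 u v) = 0 := by
  simp [dot3, cross3]
  ring

theorem dot3_cross3_cross3 (u v a b : Fin 3 → ℝ) :
    dot3 (cross3 u v) (cross3 a b) = dot3 u a * dot3 v b - dot3 u b * dot3 v a := by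
  simp [dot3, cross3]
  ring

/-- The cross product of two vectors orthogonal to a unit vector is a multiple of that vector. -/
theorem cross3_eq_smul_of_orthogonal {u v n : Fin 3 → ℝ} (hu : dot3 u n = 0) (hv : dot3 v n = 0)
    (hn : dot3 n n = 1) : cross3 u v = dot3 (cross3 u v) n • n := by
  simp only [dot3] at hu hv hn
  ext i
  fin_cases i <;> simp [dot3, cross3]
  · linear_combination (-(u 1 * v 2 - u 2 * v 1)) * hn + (n 1 * v 2 - n 2 * v 1) * hu
      - (n 1 * u 2 - n 2 * u 1) * hv
  · linear_combination (-(u 2 * v 0 - u 0 * v 2)) * hn + (n 2 * v 0 - n 0 * v 2) * hu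
      - (n 2 * u 0 - n 0 * u 2) * hv
  · linear_combination (-(u 0 * v 1 - u 1 * v 0)) * hn + (n 0 * v 1 - n 1 * v 0) * hu
      - (n 0 * u 1 - n 1 * u 0) * hv

theorem smul_cross3_of_orthogonal {u v a b n : Fin 3 → ℝ} (hu : dot3 u n = 0) (hv : dot3 v n = 0)
    (ha : dot3 a n = 0) (hb : dot3 b n = 0) (hn : dot3 n n = 1) :
    dot3 (cross3 a b) (cross3 a b) • cross3 u v
      = dot3 (cross3 u v) (cross3 a b) • cross3 a b := by
  rw [cross3_eq_smul_of_orthogonal hu hv hn, cross3_eq_smul_of_orthogonal ha hb hn]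
  simp only [dot3_smul_left, dot3_smul_right, hn, smul_smul]
  congr 1
  ring

theorem dot3_normalize_self {u : Fin 3 → ℝ} (hu : u ≠ 0) :
    dot3 ((norm3 u)⁻¹ • u) ((norm3 u)⁻¹ • u) = 1 := by
  have h := dot3_self_pos hu
  have hs : norm3 u ^ 2 = dot3 u u := Real.sq_sqrt h.le
  have hne : norm3 u ≠ 0 := (Real.sqrt_pos.2 h).ne'
  rw [dot3_smul_left, dot3_smul_right, ← hs]
  field_simp

theorem DifferentiableAt.cross3 {u v : ℝ × ℝ → Fin 3 → ℝ} {p : ℝ × ℝ}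
    (hu : DifferentiableAt ℝ u p) (hv : DifferentiableAt ℝ v p) :
    DifferentiableAt ℝ (fun q => cross3 (u q) (v q)) p := by
  have hu' := differentiableAt_pi.1 hu
  have hv' := differentiableAt_pi.1 hv
  refine differentiableAt_pi.2 fun i => ?_
  fin_cases i
  · exact ((hu' 1).mul (hv' 2)).sub ((hu' 2).mul (hv' 1))
  · exact ((hu' 2).mul (hv' 0)).sub ((hu' 0).mul (hv' 2))
  · exact ((hu' 0).mul (hv' 1)).sub ((hu' 1).mul (hv' 0))

theorem DifferentiableAt.normalize3 {u : ℝ × ℝ → Fin 3 → ℝ} {p : ℝ × ℝ}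
    (hu : DifferentiableAt ℝ u p) (h0 : u p ≠ 0) :
    DifferentiableAt ℝ (fun q => (norm3 (u q))⁻¹ • u q) p := by
  have hu' := differentiableAt_pi.1 hu
  have hd : DifferentiableAt ℝ (fun q => dot3 (u q) (u q)) p :=
    (((hu' 0).mul (hu' 0)).add ((hu' 1).mul (hu' 1))).add ((hu' 2).mul (hu' 2))
  have h := dot3_self_pos h0
  exact ((hd.sqrt h.ne').inv (Real.sqrt_pos.2 h).ne').smul hu

theorem fderiv_fderiv_apply {g : ℝ × ℝ → Fin 3 → ℝ} {p : ℝ × ℝ}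
    (hg : DifferentiableAt ℝ (fderiv ℝ g) p) (v w : ℝ × ℝ) :
    fderiv ℝ (fun q => fderiv ℝ g q v) p w = fderiv ℝ (fderiv ℝ g) p w v := by
  have h := hg.hasFDerivAt.clm_apply (hasFDerivAt_const v p)
  rw [h.fderiv]
  simp

/-- The partial derivatives of `g` commute where `g` is smooth. -/
theorem py_px_eq_px_py {g : ℝ × ℝ → Fin 3 → ℝ} {p : ℝ × ℝ}
    (hg : ContDiffAt ℝ (⊤ : ℕ∞) g p) : py (px g) p = px (py g) p := by
  have hd : DifferentiableAt ℝ (fderiv ℝ g) p :=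
    (hg.fderiv_right (m := 1) (by norm_cast)).differentiableAt (by norm_num)
  have hs : IsSymmSndFDerivAt ℝ g p := hg.isSymmSndFDerivAt (by simp; norm_cast)
  exact (fderiv_fderiv_apply hd (1, 0) (0, 1)).trans
    ((hs.eq (0, 1) (1, 0)).trans (fderiv_fderiv_apply hd (0, 1) (1, 0)).symm)

/-- properties of the parallel surface `f = g + (1/(2H₁))·N` of a CMC surface. -/
theorem stmt0 (Ω : Set (ℝ × ℝ)) (hΩ : IsOpen Ω)
    (g N f : ℝ × ℝ → Fin 3 → ℝ)
    (hg : ContDiffOn ℝ (⊤ : ℕ∞) g Ω)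
    (himm : ∀ p ∈ Ω, cross3 (px g p) (py g p) ≠ 0)
    (hN : ∀ p ∈ Ω, N p = (norm3 (cross3 (px g p) (py g p)))⁻¹ • cross3 (px g p) (py g p))
    (H₁ : ℝ) (hH₁ : H₁ ≠ 0)
    (hmean : ∀ p ∈ Ω, MeanH g N p = H₁)
    (hf : ∀ p, f p = g p + (1 / (2 * H₁)) • N p) :
    ∀ p ∈ Ω,
      dot3 (px f p) (N p) = 0 ∧ dot3 (py f p) (N p) = 0 ∧
      cross3 (px f p) (py f p) = (GaussK g N p / (4 * H₁ ^ 2)) • cross3 (px g p) (py g p) ∧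
      (cross3 (px f p) (py f p) ≠ 0 ↔ GaussK g N p ≠ 0) := by
  have hdg : ∀ p ∈ Ω, ContDiffAt ℝ (⊤ : ℕ∞) g p := fun p hp => hg.contDiffAt (hΩ.mem_nhds hp)
  have hd2 : ∀ p ∈ Ω, DifferentiableAt ℝ (fderiv ℝ g) p := fun p hp =>
    ((hdg p hp).fderiv_right (m := 1) (by norm_cast)).differentiableAt (by norm_num)
  have hNN : ∀ q ∈ Ω, dot3 (N q) (N q) = 1 := fun q hq => by
    rw [hN q hq, dot3_normalize_self (himm q hq)]
  have hxN : ∀ q ∈ Ω, dot3 (px g q) (N q) = 0 := fun q hq => by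
    rw [hN q hq, dot3_smul_right, dot3_cross3_left, mul_zero]
  have hyN : ∀ q ∈ Ω, dot3 (py g q) (N q) = 0 := fun q hq => by
    rw [hN q hq, dot3_smul_right, dot3_cross3_right, mul_zero]
  intro p hp
  have hev : ∀ᶠ q in nhds p, q ∈ Ω := hΩ.mem_nhds hp
  have hdx : DifferentiableAt ℝ (px g) p := (hd2 p hp).clm_apply (differentiableAt_const _)
  have hdy : DifferentiableAt ℝ (py g) p := (hd2 p hp).clm_apply (differentiableAt_const _)
  have hdN : DifferentiableAt ℝ N p :=
    ((hdx.cross3 hdy).normalize3 (himm p hp)).congr_of_eventuallyEq (hev.mono hN)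
  have hdg1 : DifferentiableAt ℝ g p := (hdg p hp).differentiableAt (by simp)
  have hff : fderiv ℝ f p = fderiv ℝ g p + (1 / (2 * H₁)) • fderiv ℝ N p := by
    rw [funext hf]
    exact (hdg1.hasFDerivAt.add (hdN.hasFDerivAt.const_smul (1 / (2 * H₁)))).fderiv
  have hfx : px f p = px g p + (1 / (2 * H₁)) • px N p := by simp only [px, hff]; rfl
  have hfy : py f p = py g p + (1 / (2 * H₁)) • py N p := by simp only [py, hff]; rfl
  have hNw : ∀ w, dot3 (fderiv ℝ N p w) (N p) = 0 := fun w => by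
    have h := dot3_fderiv_add_eq_zero hdN hdN (hev.mono hNN) w
    rw [dot3_comm (N p)] at h
    linarith
  have hl : dot3 (px (px g) p) (N p) + dot3 (px g p) (px N p) = 0 :=
    dot3_fderiv_add_eq_zero hdx hdN (hev.mono hxN) (1, 0)
  have hm : dot3 (py (px g) p) (N p) + dot3 (px g p) (py N p) = 0 :=
    dot3_fderiv_add_eq_zero hdx hdN (hev.mono hxN) (0, 1)
  have hm' : dot3 (py (px g) p) (N p) + dot3 (py g p) (px N p) = 0 := by
    rw [py_px_eq_px_py (hdg p hp)]
    exact dot3_fderiv_add_eq_zero hdy hdN (hev.mono hyN) (1, 0)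
  have hn : dot3 (py (py g) p) (N p) + dot3 (py g p) (py N p) = 0 :=
    dot3_fderiv_add_eq_zero hdy hdN (hev.mono hyN) (0, 1)
  have hfxN : dot3 (px f p) (N p) = 0 := by
    rw [hfx, dot3_add_smul_left, hxN p hp, show dot3 (px N p) (N p) = 0 from hNw _]
    simp
  have hfyN : dot3 (py f p) (N p) = 0 := by
    rw [hfy, dot3_add_smul_left, hyN p hp, show dot3 (py N p) (N p) = 0 from hNw _]
    simp
  have hD := dot3_self_pos (himm p hp)
  have hcross : cross3 (px f p) (py f p)
      = (GaussK g N p / (4 * H₁ ^ 2)) • cross3 (px g p) (py g p) := by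
    have key := smul_cross3_of_orthogonal hfxN hfyN (hxN p hp) (hyN p hp) (hNN p hp)
    have hval : dot3 (cross3 (px f p) (py f p)) (cross3 (px g p) (py g p))
        = dot3 (cross3 (px g p) (py g p)) (cross3 (px g p) (py g p))
          * (GaussK g N p / (4 * H₁ ^ 2)) := by
      have hH := hmean p hp
      unfold MeanH at hH
      rw [dot3_cross3_cross3] at hD
      rw [dot3_cross3_cross3, dot3_cross3_cross3, hfx, hfy]
      simp only [dot3_add_smul_left]
      rw [dot3_comm (px N p), dot3_comm (px N p), dot3_comm (py N p), dot3_comm (py N p)]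
      rw [dot3_comm (py g p) (px g p)] at hD ⊢
      rw [div_eq_iff (by nlinarith)] at hH
      have hK : GaussK g N p * (dot3 (px g p) (px g p) * dot3 (py g p) (py g p)
            - dot3 (px g p) (py g p) ^ 2)
          = dot3 (px (px g) p) (N p) * dot3 (py (py g) p) (N p) - dot3 (py (px g) p) (N p) ^ 2 :=
        div_mul_cancel₀ _ (by nlinarith)
      rw [eq_neg_of_add_eq_zero_right hl, eq_neg_of_add_eq_zero_right hm,
        eq_neg_of_add_eq_zero_right hm', eq_neg_of_add_eq_zero_right hn]
      field_simp
      linear_combination (-8 * H₁) * hH - 4 * hK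
    rw [hval, mul_smul] at key
    exact smul_right_injective _ hD.ne' key
  refine ⟨hfxN, hfyN, hcross, ?_⟩
  rw [hcross, smul_ne_zero_iff]
  simp [himm p hp, hH₁]
end
end

section
/- Let Ω ⊆ ℝ² be open and simply connected, let N : Ω → ℝ³ be smooth with ‖N(p)‖ = 1 for all p ∈ Ω, and let a ∈ ℝ be a constant. Then N × (N_xx + N_yy) = 0 holds on Ω if and only if there exists a smooth map f : Ω → ℝ³ satisfying f_x = N × N_y + a·N_x and f_y = −N × N_x + a·N_y on Ω. (The case a = 0 produces the spherical frontal associated to the harmonic map N, and the case a = −1 produces the associated constant mean curvature surface.) -/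
noncomputable section

open Real

open Set Filter Topology

/-- On a simply connected space, local functions whose differences are locally constant
glue, up to local constants, to a global function. -/
theorem exists_function_of_locally_const_sub {B ι D : Type*} [TopologicalSpace B]
    [SimplyConnectedSpace B] [LocallyPathConnectedSpace B] [AddCommGroup D]
    (U : ι → Set B) (hU : ∀ i, IsOpen (U i)) (hcover : ∀ x, ∃ i, x ∈ U i) (g : ι → B → D)
    (hg : ∀ i j, ∀ x ∈ U i ∩ U j, ∀ᶠ y in 𝓝 x, g i y - g j y = g i x - g j x) :
    ∃ f : B → D, ∀ i, ∀ x ∈ U i, ∀ᶠ y in 𝓝 x, f y - g i y = f x - g i x := by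
  let _ : TopologicalSpace D := ⊥
  have : DiscreteTopology D := ⟨rfl⟩
  choose idx hidx using hcover
  let Z : FiberBundleCore ι B D :=
    { baseSet := U
      isOpen_baseSet := hU
      indexAt := idx
      mem_baseSet_at := hidx
      coordChange := fun i j x v => v + (g i x - g j x)
      coordChange_self := by simp
      continuousOn_coordChange := by
        rintro i j ⟨x, v⟩ ⟨hx, -⟩
        refine ContinuousAt.continuousWithinAt ?_
        refine continuousAt_snd.add ?_
        refine ContinuousAt.comp (f := Prod.fst) (g := fun x => g i x - g j x) ?_ continuousAt_fst
        exact continuousAt_const.congr ((hg i j x hx).mono fun y hy => hy.symm)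
      coordChange_comp := by
        intro i j k x _ v
        abel }
  have hcov : IsCoveringMap (Bundle.TotalSpace.proj : Bundle.TotalSpace D Z.Fiber → B) :=
    FiberBundle.isCoveringMap (F := D) (E := Z.Fiber)
  obtain ⟨x₀⟩ : Nonempty B := inferInstance
  obtain ⟨s, ⟨-, hs⟩, -⟩ := hcov.existsUnique_continuousMap_lifts (ContinuousMap.id B) x₀
    (⟨x₀, (0 : D)⟩ : Bundle.TotalSpace D Z.Fiber) rfl
  have hproj : ∀ x, (s x).proj = x := fun x => congrFun hs x
  refine ⟨fun x => (show D from (s x).snd) + g (idx x) x, fun i x hx => ?_⟩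
  have hcont : ContinuousAt (fun y => (Z.localTriv i (s y)).2) x := by
    have h1 : ContinuousAt (Z.localTriv i) (s x) := by
      refine (Z.localTriv i).toOpenPartialHomeomorph.continuousAt ?_
      rw [Z.mem_localTriv_source]
      change (s x).proj ∈ U i
      rwa [hproj]
    exact (continuousAt_snd).comp (ContinuousAt.comp (f := s) h1 s.continuous.continuousAt)
  have hloc : ∀ᶠ y in 𝓝 x, (Z.localTriv i (s y)).2 = (Z.localTriv i (s x)).2 :=
    hcont.eventually (by rw [nhds_discrete]; exact eventually_pure.2 rfl :
      ∀ᶠ v in 𝓝 (Z.localTriv i (s x)).2, v = (Z.localTriv i (s x)).2)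
  have hval : ∀ y, (Z.localTriv i (s y)).2 = (show D from (s y).snd) + (g (idx y) y - g i y) := by
    intro y
    rw [Z.localTriv_apply]
    simp only [hproj y]
    rfl
  filter_upwards [hloc] with y hy
  rw [hval, hval] at hy
  rw [add_sub_assoc, add_sub_assoc]
  exact hy

/-- Poincaré lemma: a closed `1`-form on a simply connected open set has a primitive. -/
theorem exists_hasFDerivAt_of_fderiv_symmetric {E F : Type*} [NormedAddCommGroup E]
    [NormedSpace ℝ E] [NormedAddCommGroup F] [NormedSpace ℝ F] [CompleteSpace F]
    {s : Set E} (hs : IsSimplyConnected s) (hso : IsOpen s) {ω : E → E →L[ℝ] F}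
    (hω : DifferentiableOn ℝ ω s)
    (hdω : ∀ p ∈ s, ∀ u v, fderiv ℝ ω p u v = fderiv ℝ ω p v u) :
    ∃ f : E → F, ∀ p ∈ s, HasFDerivAt f (ω p) p := by
  classical
  have := hs.simplyConnectedSpace
  have := hso.locallyPathConnectedSpace
  choose r hr hrs using fun p : s => Metric.isOpen_iff.1 hso p p.2
  choose g hg using fun p : s =>
    (convex_ball (p : E) (r p)).exists_forall_hasFDerivAt_of_fderiv_symmetric Metric.isOpen_ball
      (hω.mono (hrs p)) (fun q hq => hdω q (hrs p hq))
  obtain ⟨f, hf⟩ := exists_function_of_locally_const_sub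
    (fun p : s => ((↑) : s → E) ⁻¹' Metric.ball p (r p))
    (fun p => Metric.isOpen_ball.preimage continuous_subtype_val)
    (fun p => ⟨p, Metric.mem_ball_self (hr p)⟩) (fun p x => g p x) (by
      rintro i j x ⟨hxi, hxj⟩
      have hO : IsOpen (Metric.ball (i : E) (r i) ∩ Metric.ball (j : E) (r j)) :=
        Metric.isOpen_ball.inter Metric.isOpen_ball
      have hd : ∀ y ∈ Metric.ball (i : E) (r i) ∩ Metric.ball (j : E) (r j),
          HasFDerivAt (fun z => g i z - g j z) (0 : E →L[ℝ] F) y := fun y hy => by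
        simpa [Pi.sub_def] using (hg i y hy.1).sub (hg j y hy.2)
      have hev : ∀ᶠ y : s in 𝓝 x, (y : E) ∈ Metric.ball (i : E) (r i) ∩ Metric.ball (j : E) (r j) :=
        continuous_subtype_val.continuousAt.eventually (hO.mem_nhds ⟨hxi, hxj⟩)
      filter_upwards [hev] with y hy
      have hconv := (convex_ball (i : E) (r i)).inter (convex_ball (j : E) (r j))
      refine hconv.is_const_of_fderivWithin_eq_zero (𝕜 := ℝ) (f := fun z => g i z - g j z)
        (fun z hz => (hd z hz).differentiableAt.differentiableWithinAt) (fun z hz => ?_)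
        hy ⟨hxi, hxj⟩
      exact (hd z hz).hasFDerivWithinAt.fderivWithin (hO.uniqueDiffWithinAt hz))
  refine ⟨fun z => if hz : z ∈ s then f ⟨z, hz⟩ else 0, fun p hp => ?_⟩
  have h1 := hf ⟨p, hp⟩ ⟨p, hp⟩ (Metric.mem_ball_self (hr ⟨p, hp⟩))
  rw [nhds_subtype_eq_comap, eventually_comap] at h1
  refine ((hg ⟨p, hp⟩ p (Metric.mem_ball_self (hr ⟨p, hp⟩))).add_const
    (f ⟨p, hp⟩ - g ⟨p, hp⟩ p)).congr_of_eventuallyEq ?_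
  filter_upwards [h1, hso.mem_nhds hp] with z hz hzs
  rw [dif_pos hzs]
  have := hz ⟨z, hzs⟩ rfl
  simp only at this
  rw [← this]; abel

theorem contDiffOn_infty_of_hasFDerivAt {E F : Type*} [NormedAddCommGroup E] [NormedSpace ℝ E]
    [NormedAddCommGroup F] [NormedSpace ℝ F] {s : Set E} (hs : IsOpen s) {f : E → F}
    {ω : E → E →L[ℝ] F} (hω : ContDiffOn ℝ (⊤ : ℕ∞) ω s) (hf : ∀ p ∈ s, HasFDerivAt f (ω p) p) :
    ContDiffOn ℝ (⊤ : ℕ∞) f s := by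
  have h : ContDiffOn ℝ ((⊤ : ℕ∞) + 1) f s :=
    (contDiffOn_succ_iff_fderiv_of_isOpen hs).2
      ⟨fun p hp => (hf p hp).differentiableAt.differentiableWithinAt, by simp,
        hω.congr fun p hp => (hf p hp).fderiv⟩
  exact h.of_le (by simp)

/-- The cross product as a continuous bilinear map. -/
def cross3L : (Fin 3 → ℝ) →L[ℝ] (Fin 3 → ℝ) →L[ℝ] (Fin 3 → ℝ) :=
  (crossProduct (R := ℝ)).toContinuousBilinearMap

theorem cross3L_apply (u v : Fin 3 → ℝ) : cross3L u v = cross3 u v := by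
  rw [cross3L, LinearMap.toContinuousBilinearMap_apply, cross_apply, cross3]

theorem ContDiffOn.fderiv_apply_const {E F : Type*} [NormedAddCommGroup E] [NormedSpace ℝ E]
    [NormedAddCommGroup F] [NormedSpace ℝ F] {s : Set E} (hs : IsOpen s) {f : E → F}
    (hf : ContDiffOn ℝ (⊤ : ℕ∞) f s) (v : E) :
    ContDiffOn ℝ (⊤ : ℕ∞) (fun p => fderiv ℝ f p v) s :=
  (hf.fderiv_of_isOpen hs (by simp)).clm_apply contDiffOn_const

theorem py_px_eq_px_py_s3 {Ω : Set (ℝ × ℝ)} (hΩ : IsOpen Ω) {f : ℝ × ℝ → Fin 3 → ℝ}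
    (hf : ContDiffOn ℝ (⊤ : ℕ∞) f Ω) {p : ℝ × ℝ} (hp : p ∈ Ω) : py (px f) p = px (py f) p := by
  have hd : DifferentiableAt ℝ (fderiv ℝ f) p :=
    ((hf.fderiv_of_isOpen hΩ (m := (⊤ : ℕ∞)) (by simp)).contDiffAt
      (hΩ.mem_nhds hp)).differentiableAt (by simp)
  have hsymm : IsSymmSndFDerivAt ℝ f p :=
    (hf.contDiffAt (hΩ.mem_nhds hp)).isSymmSndFDerivAt
      (by rw [minSmoothness_of_isRCLikeNormedField]; exact WithTop.coe_le_coe.2 le_top)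
  change fderiv ℝ (fun q => fderiv ℝ f q (1, 0)) p (0, 1)
    = fderiv ℝ (fun q => fderiv ℝ f q (0, 1)) p (1, 0)
  rw [fderiv_clm_apply hd (differentiableAt_const _), fderiv_clm_apply hd (differentiableAt_const _)]
  simpa using hsymm.eq (0, 1) (1, 0)

theorem fderiv_cross3_add_smul {M P Q : ℝ × ℝ → Fin 3 → ℝ} {p : ℝ × ℝ}
    (hM : DifferentiableAt ℝ M p) (hP : DifferentiableAt ℝ P p) (hQ : DifferentiableAt ℝ Q p)
    (b a : ℝ) (v : ℝ × ℝ) :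
    fderiv ℝ (fun q => b • cross3 (M q) (P q) + a • Q q) p v =
      b • (cross3 (M p) (fderiv ℝ P p v) + cross3 (fderiv ℝ M p v) (P p)) + a • fderiv ℝ Q p v := by
  simp_rw [← cross3L_apply]
  have h := ((cross3L.hasFDerivAt_of_bilinear hM.hasFDerivAt hP.hasFDerivAt).const_smul b).add
    (hQ.hasFDerivAt.const_smul a)
  have h' := congrArg (fun L => L v) h.fderiv
  exact h'.trans (by simp)

/-- The `1`-form `A dx + B dy`. -/
def oneForm (A B : ℝ × ℝ → Fin 3 → ℝ) (p : ℝ × ℝ) : ℝ × ℝ →L[ℝ] Fin 3 → ℝ :=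
  (ContinuousLinearMap.fst ℝ ℝ ℝ).smulRight (A p) + (ContinuousLinearMap.snd ℝ ℝ ℝ).smulRight (B p)

theorem ContDiffOn.oneForm {A B : ℝ × ℝ → Fin 3 → ℝ} {s : Set (ℝ × ℝ)} {n : WithTop ℕ∞}
    (hA : ContDiffOn ℝ n A s) (hB : ContDiffOn ℝ n B s) : ContDiffOn ℝ n (oneForm A B) s :=
  (contDiffOn_const.smulRight hA).add (contDiffOn_const.smulRight hB)

theorem fderiv_oneForm_symmetric {A B : ℝ × ℝ → Fin 3 → ℝ} {p : ℝ × ℝ}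
    (hA : DifferentiableAt ℝ A p) (hB : DifferentiableAt ℝ B p) (h : py A p = px B p)
    (u v : ℝ × ℝ) : fderiv ℝ (oneForm A B) p u v = fderiv ℝ (oneForm A B) p v u := by
  have hd : HasFDerivAt (oneForm A B)
      ((ContinuousLinearMap.smulRightL ℝ (ℝ × ℝ) (Fin 3 → ℝ) (ContinuousLinearMap.fst ℝ ℝ ℝ)).comp
          (fderiv ℝ A p) +
        (ContinuousLinearMap.smulRightL ℝ (ℝ × ℝ) (Fin 3 → ℝ) (ContinuousLinearMap.snd ℝ ℝ ℝ)).comp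
          (fderiv ℝ B p)) p :=
    (((ContinuousLinearMap.smulRightL ℝ (ℝ × ℝ) (Fin 3 → ℝ)
      (ContinuousLinearMap.fst ℝ ℝ ℝ)).hasFDerivAt).comp p hA.hasFDerivAt).add
    (((ContinuousLinearMap.smulRightL ℝ (ℝ × ℝ) (Fin 3 → ℝ)
      (ContinuousLinearMap.snd ℝ ℝ ℝ)).hasFDerivAt).comp p hB.hasFDerivAt)
  have hdecomp : ∀ (L : ℝ × ℝ →L[ℝ] Fin 3 → ℝ) (w : ℝ × ℝ),
      L w = w.1 • L (1, 0) + w.2 • L (0, 1) := by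
    intro L w
    rw [← map_smul, ← map_smul, ← map_add]
    simp
  rw [hd.fderiv]
  change v.1 • fderiv ℝ A p u + v.2 • fderiv ℝ B p u =
    u.1 • fderiv ℝ A p v + u.2 • fderiv ℝ B p v
  rw [hdecomp (fderiv ℝ A p) u, hdecomp (fderiv ℝ A p) v, hdecomp (fderiv ℝ B p) u,
    hdecomp (fderiv ℝ B p) v]
  change fderiv ℝ A p (0, 1) = fderiv ℝ B p (1, 0) at h
  rw [h]
  module

theorem cross3_self (u : Fin 3 → ℝ) : cross3 u u = 0 := by
  rw [cross3, ← cross_apply, cross_self]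

/-- The closedness condition of the `1`-form `(N × N_y + a N_x) dx + (-N × N_x + a N_y) dy`
is the harmonic map equation. -/
theorem py_eq_px_iff_cross3_eq_zero {Ω : Set (ℝ × ℝ)} (hΩ : IsOpen Ω) {N : ℝ × ℝ → Fin 3 → ℝ}
    (hN : ContDiffOn ℝ (⊤ : ℕ∞) N Ω) (a : ℝ) {p : ℝ × ℝ} (hp : p ∈ Ω) :
    py (fun q => cross3 (N q) (py N q) + a • px N q) p =
        px (fun q => -(cross3 (N q) (px N q)) + a • py N q) p ↔
      cross3 (N p) (px (px N) p + py (py N) p) = 0 := by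
  have hd {f : ℝ × ℝ → Fin 3 → ℝ} (hf : ContDiffOn ℝ (⊤ : ℕ∞) f Ω) : DifferentiableAt ℝ f p :=
    (hf.contDiffAt (hΩ.mem_nhds hp)).differentiableAt (by simp)
  have hNx : DifferentiableAt ℝ (px N) p := hd (hN.fderiv_apply_const hΩ (1, 0))
  have hNy : DifferentiableAt ℝ (py N) p := hd (hN.fderiv_apply_const hΩ (0, 1))
  have h1 : py (fun q => cross3 (N q) (py N q) + a • px N q) p =
      cross3 (N p) (py (py N) p) + a • py (px N) p := by
    have := fderiv_cross3_add_smul (hd hN) hNy hNx 1 a (0, 1)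
    simp only [one_smul] at this
    change py _ p = cross3 (N p) (py (py N) p) + cross3 (py N p) (py N p) + a • py (px N) p at this
    rwa [cross3_self, add_zero] at this
  have h2 : px (fun q => -(cross3 (N q) (px N q)) + a • py N q) p =
      -(cross3 (N p) (px (px N) p)) + a • px (py N) p := by
    have := fderiv_cross3_add_smul (hd hN) hNx hNy (-1) a (1, 0)
    simp only [neg_smul, one_smul] at this
    change px _ p = -(cross3 (N p) (px (px N) p) + cross3 (px N p) (px N p)) + a • px (py N) p
      at this
    rwa [cross3_self, add_zero] at this
  rw [h1, h2, py_px_eq_px_py_s3 hΩ hN hp, add_left_inj, ← cross3L_apply, ← cross3L_apply,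
    ← cross3L_apply, map_add, eq_neg_iff_add_eq_zero, add_comm]

/-- on a simply connected domain, a unit vector field `N` is harmonic iff the
equations `f_x = N × N_y + a·N_x`, `f_y = −N × N_x + a·N_y` are integrable. -/
theorem stmt3 (Ω : Set (ℝ × ℝ)) (hΩ : IsOpen Ω) (hsc : SimplyConnectedSpace Ω)
    (N : ℝ × ℝ → Fin 3 → ℝ) (hN : ContDiffOn ℝ (⊤ : ℕ∞) N Ω)
    (hunit : ∀ p ∈ Ω, norm3 (N p) = 1) (a : ℝ) :
    (∀ p ∈ Ω, cross3 (N p) (px (px N) p + py (py N) p) = 0) ↔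
      ∃ f : ℝ × ℝ → Fin 3 → ℝ, ContDiffOn ℝ (⊤ : ℕ∞) f Ω ∧
        ∀ p ∈ Ω, px f p = cross3 (N p) (py N p) + a • px N p ∧
          py f p = -(cross3 (N p) (px N p)) + a • py N p := by
  have hNx : ContDiffOn ℝ (⊤ : ℕ∞) (px N) Ω := hN.fderiv_apply_const hΩ (1, 0)
  have hNy : ContDiffOn ℝ (⊤ : ℕ∞) (py N) Ω := hN.fderiv_apply_const hΩ (0, 1)
  have hcross {P : ℝ × ℝ → Fin 3 → ℝ} (hP : ContDiffOn ℝ (⊤ : ℕ∞) P Ω) :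
      ContDiffOn ℝ (⊤ : ℕ∞) (fun q => cross3 (N q) (P q)) Ω := by
    simp_rw [← cross3L_apply]
    exact cross3L.isBoundedBilinearMap.contDiff.comp_contDiffOn (hN.prodMk hP)
  constructor
  · intro hharm
    set A : ℝ × ℝ → Fin 3 → ℝ := fun q => cross3 (N q) (py N q) + a • px N q
    set B : ℝ × ℝ → Fin 3 → ℝ := fun q => -(cross3 (N q) (px N q)) + a • py N q
    have hA : ContDiffOn ℝ (⊤ : ℕ∞) A Ω := (hcross hNy).add (hNx.const_smul a)
    have hB : ContDiffOn ℝ (⊤ : ℕ∞) B Ω := (hcross hNx).neg.add (hNy.const_smul a)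
    have hω := hA.oneForm hB
    obtain ⟨f, hf⟩ := exists_hasFDerivAt_of_fderiv_symmetric hsc hΩ
      (hω.differentiableOn (by simp)) fun p hp =>
        fderiv_oneForm_symmetric
          ((hA.contDiffAt (hΩ.mem_nhds hp)).differentiableAt (by simp))
          ((hB.contDiffAt (hΩ.mem_nhds hp)).differentiableAt (by simp))
          ((py_eq_px_iff_cross3_eq_zero hΩ hN a hp).2 (hharm p hp))
    refine ⟨f, contDiffOn_infty_of_hasFDerivAt hΩ hω hf, fun p hp => ?_⟩
    change fderiv ℝ f p (1, 0) = A p ∧ fderiv ℝ f p (0, 1) = B p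
    simp [(hf p hp).fderiv, oneForm]
  · rintro ⟨f, hf, hfxy⟩ p hp
    rw [← py_eq_px_iff_cross3_eq_zero hΩ hN a hp]
    have hx : px f =ᶠ[𝓝 p] fun q => cross3 (N q) (py N q) + a • px N q := by
      filter_upwards [hΩ.mem_nhds hp] with q hq using (hfxy q hq).1
    have hy : py f =ᶠ[𝓝 p] fun q => -(cross3 (N q) (px N q)) + a • py N q := by
      filter_upwards [hΩ.mem_nhds hp] with q hq using (hfxy q hq).2
    have h := py_px_eq_px_py_s3 hΩ hf hp
    rw [py, px, hx.fderiv_eq, hy.fderiv_eq] at h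
    exact h
end
end

section
/- Let Ω ⊆ ℝ² be open, let N : Ω → ℝ³ be smooth with ‖N(p)‖ = 1 for all p, and let f : Ω → ℝ³ be smooth with f_x = N × N_y and f_y = −N × N_x on Ω. Then the Legendrian lift (f, N) : Ω → ℝ³ × ℝ³ is an immersion at a point p (i.e., its total derivative at p is injective) if and only if the total derivative of N at p is nonzero; equivalently, the frontal f is a front exactly at the points where its derivative has rank at least 1. -/
noncomputable section

open Real

lemma eq_zero_of_cross3_eq_zero {n w : Fin 3 → ℝ} (hn : dot3 n n = 1) (hw : dot3 n w = 0)
    (h : cross3 n w = 0) : w = 0 := by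
  have h0 : n 1 * w 2 - n 2 * w 1 = 0 := by simpa [cross3] using congrFun h 0
  have h1 : n 2 * w 0 - n 0 * w 2 = 0 := by simpa [cross3] using congrFun h 1
  have h2 : n 0 * w 1 - n 1 * w 0 = 0 := by simpa [cross3] using congrFun h 2
  unfold dot3 at hn hw
  ext i
  fin_cases i <;> simp only [Fin.zero_eta, Fin.mk_one, Fin.reduceFinMk, Pi.zero_apply]
  · linear_combination n 0 * hw - w 0 * hn - n 1 * h2 + n 2 * h1
  · linear_combination n 1 * hw - w 1 * hn + n 0 * h2 - n 2 * h0
  · linear_combination n 2 * hw - w 2 * hn - n 0 * h1 + n 1 * h0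

lemma cross3_zero (n : Fin 3 → ℝ) : cross3 n 0 = 0 := by
  ext i
  fin_cases i <;> simp [cross3]

lemma cross3_smul_sub_smul (n u v : Fin 3 → ℝ) (a b : ℝ) :
    cross3 n (a • v - b • u) = a • cross3 n v + b • -cross3 n u := by
  ext i
  fin_cases i <;> simp [cross3] <;> ring

lemma dot3_smul_sub_smul (n u v : Fin 3 → ℝ) (a b : ℝ) :
    dot3 n (a • v - b • u) = a * dot3 n v - b * dot3 n u := by
  simp only [dot3, Pi.sub_apply, Pi.smul_apply, smul_eq_mul]
  ring

lemma dot3_self_eq_one_of_norm3_eq_one {u : Fin 3 → ℝ} (h : norm3 u = 1) : dot3 u u = 1 :=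
  Real.sqrt_eq_one.mp h

/-- A unit vector field is orthogonal to its derivatives. -/
lemma dot3_fderiv_eq_zero {N : ℝ × ℝ → Fin 3 → ℝ} {p : ℝ × ℝ} (hN : DifferentiableAt ℝ N p)
    (hunit : ∀ᶠ q in nhds p, dot3 (N q) (N q) = 1) (w : ℝ × ℝ) :
    dot3 (N p) (fderiv ℝ N p w) = 0 := by
  have hc := hasFDerivAt_pi'.mp hN.hasFDerivAt
  have hd := (((hc 0).mul (hc 0)).add ((hc 1).mul (hc 1))).add ((hc 2).mul (hc 2))
  have hconst : HasFDerivAt (fun q => dot3 (N q) (N q)) (0 : ℝ × ℝ →L[ℝ] ℝ) p :=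
    (hasFDerivAt_const (1 : ℝ) p).congr_of_eventuallyEq hunit
  have h := DFunLike.congr_fun (hd.unique hconst) w
  simp at h
  unfold dot3
  linarith

lemma fderiv_apply_eq_smul_px_add_smul_py (g : ℝ × ℝ → Fin 3 → ℝ) (p w : ℝ × ℝ) :
    fderiv ℝ g p w = w.1 • px g p + w.2 • py g p := by
  unfold px py
  rw [← map_smul, ← map_smul, ← map_add]
  simp

lemma fderiv_eq_zero_iff_px_py (g : ℝ × ℝ → Fin 3 → ℝ) (p : ℝ × ℝ) :
    fderiv ℝ g p = 0 ↔ px g p = 0 ∧ py g p = 0 := by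
  refine ⟨fun h => by simp [px, py, h], fun h => ?_⟩
  refine ContinuousLinearMap.ext fun w => ?_
  simp [fderiv_apply_eq_smul_px_add_smul_py, h]

/-- If `a • v = b • u` and `a • u = -b • v` for some `(a, b) ≠ 0`, then `u = v = 0`. -/
lemma eq_zero_of_smul_sub_smul_eq_zero {E : Type*} [AddCommGroup E] [Module ℝ E] {u v : E}
    {a b : ℝ} (hab : (a, b) ≠ 0) (h₁ : a • v - b • u = 0) (h₂ : a • u + b • v = 0) :
    u = 0 ∧ v = 0 := by
  have hne : a * a + b * b ≠ 0 := fun h => hab <| by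
    obtain ⟨rfl, rfl⟩ := mul_self_add_mul_self_eq_zero.mp h
    rfl
  have hu : (a * a + b * b) • u = a • (a • u + b • v) - b • (a • v - b • u) := by module
  have hv : (a * a + b * b) • v = b • (a • u + b • v) + a • (a • v - b • u) := by module
  rw [h₁, h₂] at hu hv
  simp only [smul_zero, sub_zero, add_zero, smul_eq_zero, hne, false_or] at hu hv
  exact ⟨hu, hv⟩

/-- the Legendrian lift `(f,N)` of a spherical frontal is an immersion at `p`
iff `dN(p) ≠ 0`, i.e. iff `df(p)` has rank at least one. -/
theorem stmt5 (Ω : Set (ℝ × ℝ)) (hΩ : IsOpen Ω)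
    (N f : ℝ × ℝ → Fin 3 → ℝ)
    (hN : ContDiffOn ℝ (⊤ : ℕ∞) N Ω) (hf : ContDiffOn ℝ (⊤ : ℕ∞) f Ω)
    (hunit : ∀ p ∈ Ω, norm3 (N p) = 1)
    (heq : ∀ p ∈ Ω, px f p = cross3 (N p) (py N p) ∧ py f p = -(cross3 (N p) (px N p))) :
    ∀ p ∈ Ω,
      (Function.Injective (fderiv ℝ (fun q => (f q, N q)) p) ↔ fderiv ℝ N p ≠ 0) ∧
      (Function.Injective (fderiv ℝ (fun q => (f q, N q)) p) ↔
        1 ≤ LinearMap.rank (fderiv ℝ f p).toLinearMap) := by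
  intro p hp
  have hnhds := hΩ.mem_nhds hp
  have hNd : DifferentiableAt ℝ N p := (hN.contDiffAt hnhds).differentiableAt (by simp)
  have hfd : DifferentiableAt ℝ f p := (hf.contDiffAt hnhds).differentiableAt (by simp)
  have hn : dot3 (N p) (N p) = 1 := dot3_self_eq_one_of_norm3_eq_one (hunit p hp)
  have horth := dot3_fderiv_eq_zero hNd <| Filter.mem_of_superset hnhds fun q hq =>
    dot3_self_eq_one_of_norm3_eq_one (hunit q hq)
  have hx : dot3 (N p) (px N p) = 0 := horth (1, 0)
  have hy : dot3 (N p) (py N p) = 0 := horth (0, 1)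
  obtain ⟨hfx, hfy⟩ := heq p hp
  have hzero : fderiv ℝ f p = 0 ↔ fderiv ℝ N p = 0 := by
    rw [fderiv_eq_zero_iff_px_py, fderiv_eq_zero_iff_px_py, hfx, hfy, neg_eq_zero]
    refine ⟨fun h => ⟨eq_zero_of_cross3_eq_zero hn hx h.2, eq_zero_of_cross3_eq_zero hn hy h.1⟩,
      fun h => by simp [h, cross3_zero]⟩
  have hinj : Function.Injective (fderiv ℝ (fun q => (f q, N q)) p) ↔ fderiv ℝ N p ≠ 0 := by
    rw [hfd.fderiv_prodMk hNd]
    constructor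
    · intro h h0
      rw [h0, hzero.mpr h0] at h
      simpa using @h (1, 0) 0 (by simp)
    · intro h0
      rw [injective_iff_map_eq_zero]
      intro w hw
      obtain ⟨hfw, hNw⟩ : fderiv ℝ f p w = 0 ∧ fderiv ℝ N p w = 0 := by simpa using hw
      by_contra hne
      rw [fderiv_apply_eq_smul_px_add_smul_py] at hfw hNw
      rw [hfx, hfy, ← cross3_smul_sub_smul] at hfw
      have hrot := eq_zero_of_cross3_eq_zero hn (by simp [dot3_smul_sub_smul, hx, hy]) hfw
      exact h0 <| (fderiv_eq_zero_iff_px_py N p).mpr <|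
        eq_zero_of_smul_sub_smul_eq_zero hne hrot hNw
  refine ⟨hinj, hinj.trans ?_⟩
  rw [Cardinal.one_le_iff_ne_zero, ne_eq, ne_eq, LinearMap.rank, rank_zero_iff,
    Submodule.subsingleton_iff_eq_bot, LinearMap.range_eq_bot, ← hzero]
  exact not_congr (by norm_cast)
end
end

section
/- Let Ω ⊆ ℝ² be open, let N : Ω → ℝ³ be a C² map with ‖N(p)‖ = 1 for all p, and let f : Ω → ℝ³ be C² with f_x = N × N_y and f_y = −N × N_x on Ω. Then on all of Ω: ⟨f_xx, N⟩ = ⟨f_yy, N⟩ = ⟨N, N_x × N_y⟩ and ⟨f_xy, N⟩ = 0. In other words, the second fundamental form of the spherical frontal f with respect to N equals ⟨N, N_x × N_y⟩·(dx² + dy²), so the coordinates (x,y) are conformal for the metric induced by the second fundamental form. -/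
noncomputable section

open Real

/-- Differentiating `N × M` and pairing with `N` leaves only the term `⟨N, ∂ᵥN × M⟩`. -/
lemma dot3_fderiv_cross3 {N M : ℝ × ℝ → Fin 3 → ℝ} {p : ℝ × ℝ}
    (hN : DifferentiableAt ℝ N p) (hM : DifferentiableAt ℝ M p) (v : ℝ × ℝ) :
    dot3 (fderiv ℝ (fun q => cross3 (N q) (M q)) p v) (N p) =
      dot3 (N p) (cross3 (fderiv ℝ N p v) (M p)) := by
  have hN' := hasFDerivAt_pi'.1 hN.hasFDerivAt
  have hM' := hasFDerivAt_pi'.1 hM.hasFDerivAt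
  let pr (i : Fin 3) : (Fin 3 → ℝ) →L[ℝ] ℝ := ContinuousLinearMap.proj i
  let L (i j : Fin 3) : ℝ × ℝ →L[ℝ] ℝ :=
    N p i • (pr j).comp (fderiv ℝ M p) + M p j • (pr i).comp (fderiv ℝ N p)
  have hminor (i j : Fin 3) : HasFDerivAt (fun q => N q i * M q j - N q j * M q i)
      (L i j - L j i) p :=
    ((hN' i).mul (hM' j)).sub ((hN' j).mul (hM' i))
  have hcross : HasFDerivAt (fun q => cross3 (N q) (M q))
      (ContinuousLinearMap.pi ![L 1 2 - L 2 1, L 2 0 - L 0 2, L 0 1 - L 1 0]) p := by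
    refine hasFDerivAt_pi.2 fun i => ?_
    fin_cases i
    exacts [hminor 1 2, hminor 2 0, hminor 0 1]
  rw [hcross.fderiv]
  simp [dot3, cross3, L, pr]
  ring

/-- A directional derivative of a `C²` map is differentiable. -/
lemma differentiableAt_fderiv_apply_of_contDiffAt {g : ℝ × ℝ → Fin 3 → ℝ} {p : ℝ × ℝ}
    (hg : ContDiffAt ℝ 2 g p) (v : ℝ × ℝ) :
    DifferentiableAt ℝ (fun q => fderiv ℝ g q v) p :=
  ((hg.fderiv_right (m := 1) (by norm_num)).differentiableAt (by norm_num)).clm_apply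
    (differentiableAt_const v)

/-- the second fundamental form of a spherical frontal `f` with respect to `N`
is `⟨N, N_x × N_y⟩·(dx² + dy²)`. -/
theorem stmt6 (Ω : Set (ℝ × ℝ)) (hΩ : IsOpen Ω)
    (N f : ℝ × ℝ → Fin 3 → ℝ)
    (hN : ContDiffOn ℝ 2 N Ω) (hf : ContDiffOn ℝ 2 f Ω)
    (hunit : ∀ p ∈ Ω, norm3 (N p) = 1)
    (heq : ∀ p ∈ Ω, px f p = cross3 (N p) (py N p) ∧ py f p = -(cross3 (N p) (px N p))) :
    ∀ p ∈ Ω,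
      dot3 (px (px f) p) (N p) = dot3 (N p) (cross3 (px N p) (py N p)) ∧
      dot3 (py (py f) p) (N p) = dot3 (N p) (cross3 (px N p) (py N p)) ∧
      dot3 (py (px f) p) (N p) = 0 := by
  intro p hp
  have hΩp : Ω ∈ nhds p := hΩ.mem_nhds hp
  have hNp : ContDiffAt ℝ 2 N p := hN.contDiffAt hΩp
  have hNd : DifferentiableAt ℝ N p := hNp.differentiableAt (by norm_num)
  have hcross (w v : ℝ × ℝ) :=
    dot3_fderiv_cross3 hNd (differentiableAt_fderiv_apply_of_contDiffAt hNp w) v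
  have hx : px f =ᶠ[nhds p] fun q => cross3 (N q) (py N q) :=
    Filter.eventually_of_mem hΩp fun q hq => (heq q hq).1
  have hy : py f =ᶠ[nhds p] fun q => -cross3 (N q) (px N q) :=
    Filter.eventually_of_mem hΩp fun q hq => (heq q hq).2
  refine ⟨?_, ?_, ?_⟩
  · rw [px, hx.fderiv_eq]
    exact hcross (0, 1) (1, 0)
  · have h := hcross (1, 0) (0, 1)
    rw [py, hy.fderiv_eq, fderiv_fun_neg]
    simp only [dot3, cross3, px, py, neg_apply, Pi.neg_apply,
      Matrix.cons_val] at h ⊢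
    linear_combination -h
  · rw [py, hx.fderiv_eq]
    refine (hcross (0, 1) (0, 1)).trans ?_
    simp only [dot3, cross3, Matrix.cons_val]
    ring
end
end

section
/- Let Ω ⊆ ℝ² be open, let N : Ω → ℝ³ be differentiable with ‖N(p)‖ = 1 for all p, and let f : Ω → ℝ³ be differentiable with f_x = N × N_y and f_y = −N × N_x on Ω. Then f_x × f_y = ⟨N, N_x × N_y⟩·N on Ω. Consequently, f is an immersion at p if and only if ⟨N, N_x × N_y⟩(p) ≠ 0, and the singular set of f is exactly the zero set of the function ⟨N, N_x × N_y⟩. -/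
noncomputable section

open Real

/-- The cross product of `u × w` and `-(u × v)` is the triple product of `u, v, w` times `u`. -/
theorem cross3_cross3_neg_cross3 (u v w : Fin 3 → ℝ) :
    cross3 (cross3 u w) (-(cross3 u v)) = dot3 u (cross3 v w) • u := by
  ext i
  fin_cases i <;> simp [cross3, dot3] <;> ring

theorem ne_zero_of_norm3_eq_one {u : Fin 3 → ℝ} (h : norm3 u = 1) : u ≠ 0 := by
  rintro rfl
  simp [norm3, dot3] at h

/-- for a spherical frontal, `f_x × f_y = ⟨N, N_x × N_y⟩·N`, so `f` is an
immersion at `p` iff `⟨N, N_x × N_y⟩(p) ≠ 0`, and the singular set of `f` is exactly the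
zero set of `⟨N, N_x × N_y⟩`. -/
theorem stmt7 (Ω : Set (ℝ × ℝ)) (hΩ : IsOpen Ω)
    (N f : ℝ × ℝ → Fin 3 → ℝ)
    (hN : DifferentiableOn ℝ N Ω) (hf : DifferentiableOn ℝ f Ω)
    (hunit : ∀ p ∈ Ω, norm3 (N p) = 1)
    (heq : ∀ p ∈ Ω, px f p = cross3 (N p) (py N p) ∧ py f p = -(cross3 (N p) (px N p))) :
    (∀ p ∈ Ω,
      cross3 (px f p) (py f p) = dot3 (N p) (cross3 (px N p) (py N p)) • N p ∧
      (cross3 (px f p) (py f p) ≠ 0 ↔ dot3 (N p) (cross3 (px N p) (py N p)) ≠ 0)) ∧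
    {p ∈ Ω | ¬ cross3 (px f p) (py f p) ≠ 0} =
      {p ∈ Ω | dot3 (N p) (cross3 (px N p) (py N p)) = 0} := by
  have hcross : ∀ p ∈ Ω,
      cross3 (px f p) (py f p) = dot3 (N p) (cross3 (px N p) (py N p)) • N p := by
    intro p hp
    rw [(heq p hp).1, (heq p hp).2, cross3_cross3_neg_cross3]
  have hzero : ∀ p ∈ Ω,
      cross3 (px f p) (py f p) = 0 ↔ dot3 (N p) (cross3 (px N p) (py N p)) = 0 := by
    intro p hp
    rw [hcross p hp, smul_eq_zero_iff_left (ne_zero_of_norm3_eq_one (hunit p hp))]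
  refine ⟨fun p hp => ⟨hcross p hp, (hzero p hp).not⟩, ?_⟩
  ext p
  exact and_congr_right fun hp => not_not.trans (hzero p hp)
end
end

section
/- Let Ω ⊆ ℝ² be open and let U_p, U_k : Ω → M₂(ℂ) be smooth matrix-valued maps. Then the extended family A_λ, B_λ is flat at every λ ∈ ℂ∖{0} if and only if it is flat at λ = 1 and the harmonic map equations ∂_z̄U_p − [U_kᴴ, U_p] = 0 and ∂_z(U_pᴴ) + [U_k, U_pᴴ] = 0 hold on Ω. -/
noncomputable section

open Matrix

attribute [local instance] Matrix.normedAddCommGroup Matrix.normedSpace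

/-- 2×2 complex matrices. -/
abbrev M2 := Matrix (Fin 2) (Fin 2) ℂ

/-- Partial derivative in the first (x) coordinate direction. -/
def pxM (U : ℝ × ℝ → M2) (p : ℝ × ℝ) : M2 := fderiv ℝ U p (1, 0)

/-- Partial derivative in the second (y) coordinate direction. -/
def pyM (U : ℝ × ℝ → M2) (p : ℝ × ℝ) : M2 := fderiv ℝ U p (0, 1)

/-- The Wirtinger derivative `∂_z̄ = (∂_x + i∂_y)/2`. -/
def dzbar (U : ℝ × ℝ → M2) (p : ℝ × ℝ) : M2 := (2 : ℂ)⁻¹ • (pxM U p + Complex.I • pyM U p)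

/-- The Wirtinger derivative `∂_z = (∂_x − i∂_y)/2`. -/
def dzz (U : ℝ × ℝ → M2) (p : ℝ × ℝ) : M2 := (2 : ℂ)⁻¹ • (pxM U p - Complex.I • pyM U p)

/-- Commutator bracket `[X,Y] = XY − YX`. -/
def brk (X Y : M2) : M2 := X * Y - Y * X

/-- The harmonic map equations `∂_z̄U_p − [U_kᴴ, U_p] = 0` and `∂_z(U_pᴴ) + [U_k, U_pᴴ] = 0`
on `Ω`. -/
def HarmonicEqs (Up Uk : ℝ × ℝ → M2) (Ω : Set (ℝ × ℝ)) : Prop :=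
  ∀ p ∈ Ω, dzbar Up p - brk ((Uk p)ᴴ) (Up p) = 0 ∧
    dzz (fun q => (Up q)ᴴ) p + brk (Uk p) ((Up p)ᴴ) = 0

/-- `A_λ := λU_p + U_k − U_kᴴ − λ⁻¹U_pᴴ`. -/
def Amap (Up Uk : ℝ × ℝ → M2) (lam : ℂ) : ℝ × ℝ → M2 :=
  fun p => lam • Up p + Uk p - (Uk p)ᴴ - lam⁻¹ • (Up p)ᴴ

/-- `B_λ := i(λU_p + U_k + U_kᴴ + λ⁻¹U_pᴴ)`. -/
def Bmap (Up Uk : ℝ × ℝ → M2) (lam : ℂ) : ℝ × ℝ → M2 :=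
  fun p => Complex.I • (lam • Up p + Uk p + (Uk p)ᴴ + lam⁻¹ • (Up p)ᴴ)

/-- The extended family is flat at `λ`: `∂_xB_λ − ∂_yA_λ + [A_λ, B_λ] = 0` on `Ω`. -/
def FlatAt (Up Uk : ℝ × ℝ → M2) (lam : ℂ) (Ω : Set (ℝ × ℝ)) : Prop :=
  ∀ p ∈ Ω, pxM (Bmap Up Uk lam) p - pyM (Amap Up Uk lam) p
      + brk (Amap Up Uk lam p) (Bmap Up Uk lam p) = 0

/-- The pointwise conjugate transpose of a differentiable matrix map is differentiable. -/
lemma differentiableAt_conjTranspose {U : ℝ × ℝ → M2} {p : ℝ × ℝ}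
    (hU : DifferentiableAt ℝ U p) : DifferentiableAt ℝ (fun q => (U q)ᴴ) p := by
  let L : M2 →ₗ[ℝ] M2 :=
    { toFun := fun X => Xᴴ
      map_add' := fun X Y => Matrix.conjTranspose_add X Y
      map_smul' := fun r X => by simp [Matrix.conjTranspose_smul] }
  exact (LinearMap.toContinuousLinearMap L).differentiableAt.comp p hU

lemma fderiv_Amap {Up Uk : ℝ × ℝ → M2} {p : ℝ × ℝ} (hp : DifferentiableAt ℝ Up p)
    (hk : DifferentiableAt ℝ Uk p) (lam : ℂ) (v : ℝ × ℝ) :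
    fderiv ℝ (Amap Up Uk lam) p v = lam • fderiv ℝ Up p v + fderiv ℝ Uk p v
      - fderiv ℝ (fun q => (Uk q)ᴴ) p v - lam⁻¹ • fderiv ℝ (fun q => (Up q)ᴴ) p v := by
  have hpH := (differentiableAt_conjTranspose hp).hasFDerivAt
  have hkH := (differentiableAt_conjTranspose hk).hasFDerivAt
  have h := (((hp.hasFDerivAt.const_smul lam).add hk.hasFDerivAt).sub hkH).sub
    (hpH.const_smul lam⁻¹)
  exact congrArg (fun D : ℝ × ℝ →L[ℝ] M2 => D v) h.fderiv

lemma fderiv_Bmap {Up Uk : ℝ × ℝ → M2} {p : ℝ × ℝ} (hp : DifferentiableAt ℝ Up p)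
    (hk : DifferentiableAt ℝ Uk p) (lam : ℂ) (v : ℝ × ℝ) :
    fderiv ℝ (Bmap Up Uk lam) p v = Complex.I • (lam • fderiv ℝ Up p v + fderiv ℝ Uk p v
      + fderiv ℝ (fun q => (Uk q)ᴴ) p v + lam⁻¹ • fderiv ℝ (fun q => (Up q)ᴴ) p v) := by
  have hpH := (differentiableAt_conjTranspose hp).hasFDerivAt
  have hkH := (differentiableAt_conjTranspose hk).hasFDerivAt
  have h := ((((hp.hasFDerivAt.const_smul lam).add hk.hasFDerivAt).add hkH).add
    (hpH.const_smul lam⁻¹)).const_smul Complex.I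
  exact congrArg (fun D : ℝ × ℝ →L[ℝ] M2 => D v) h.fderiv

/-- The curvature of the extended family, expanded in powers of `lam`: the coefficients of `lam`
and `lam⁻¹` are the two harmonic map expressions. -/
lemma curvature_eq {Up Uk : ℝ × ℝ → M2} {p : ℝ × ℝ} (hp : DifferentiableAt ℝ Up p)
    (hk : DifferentiableAt ℝ Uk p) {lam : ℂ} (hlam : lam ≠ 0) :
    pxM (Bmap Up Uk lam) p - pyM (Amap Up Uk lam) p + brk (Amap Up Uk lam p) (Bmap Up Uk lam p)
      = (2 * Complex.I) • (lam • (dzbar Up p - brk ((Uk p)ᴴ) (Up p))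
        + lam⁻¹ • (dzz (fun q => (Up q)ᴴ) p + brk (Uk p) ((Up p)ᴴ))
        + (dzbar Uk p + dzz (fun q => (Uk q)ᴴ) p + brk (Uk p) ((Uk p)ᴴ)
          + brk (Up p) ((Up p)ᴴ))) := by
  simp only [pxM, pyM, fderiv_Amap hp hk, fderiv_Bmap hp hk, dzbar, dzz, Amap, Bmap, brk]
  generalize (Up p)ᴴ = Q
  generalize (Uk p)ᴴ = L
  simp only [mul_add, add_mul, mul_sub, sub_mul, Matrix.smul_mul, Matrix.mul_smul, smul_add,
    smul_sub, smul_smul]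
  match_scalars <;> field_simp <;> (try simp only [Complex.I_sq]) <;> ring

/-- the extended family is flat for every `λ ∈ ℂ∖{0}` iff it is flat at
`λ = 1` and the harmonic map equations hold. -/
theorem stmt10 (Ω : Set (ℝ × ℝ)) (hΩ : IsOpen Ω) (Up Uk : ℝ × ℝ → M2)
    (hUp : ContDiffOn ℝ (⊤ : ℕ∞) Up Ω) (hUk : ContDiffOn ℝ (⊤ : ℕ∞) Uk Ω) :
    (∀ lam : ℂ, lam ≠ 0 → FlatAt Up Uk lam Ω) ↔
      (FlatAt Up Uk 1 Ω ∧ HarmonicEqs Up Uk Ω) := by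
  have hd : ∀ U : ℝ × ℝ → M2, ContDiffOn ℝ (⊤ : ℕ∞) U Ω → ∀ p ∈ Ω, DifferentiableAt ℝ U p :=
    fun U hU p hp => (hU.contDiffAt (hΩ.mem_nhds hp)).differentiableAt (by simp)
  have h2I : (2 * Complex.I : ℂ) ≠ 0 := by simp
  constructor
  · intro h
    refine ⟨h 1 one_ne_zero, fun p hp => ?_⟩
    have key : ∀ lam : ℂ, lam ≠ 0 → _ := fun lam hlam =>
      (smul_eq_zero.mp ((curvature_eq (hd Up hUp p hp) (hd Uk hUk p hp) hlam).symm.trans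
        (h lam hlam p hp))).resolve_left h2I
    have h1 := key 1 one_ne_zero
    have h2 := key (-1) (by norm_num)
    have h3 := key 2 two_ne_zero
    generalize dzbar Up p - brk ((Uk p)ᴴ) (Up p) = E at *
    generalize dzz (fun q => (Up q)ᴴ) p + brk (Uk p) ((Up p)ᴴ) = F at *
    generalize dzbar Uk p + dzz (fun q => (Uk q)ᴴ) p + brk (Uk p) ((Uk p)ᴴ)
      + brk (Up p) ((Up p)ᴴ) = C at *
    have hE : E = 0 := by
      linear_combination (norm := module) (-(1/2 : ℂ)) • h1 + (-(1/6 : ℂ)) • h2 + (2/3 : ℂ) • h3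
    have hF : F = 0 := by
      linear_combination (norm := module) (1 : ℂ) • h1 + (-(1/3 : ℂ)) • h2 + (-(2/3 : ℂ)) • h3
    exact ⟨hE, hF⟩
  · rintro ⟨h1, hH⟩ lam hlam p hp
    obtain ⟨hE, hF⟩ := hH p hp
    have hC := h1 p hp
    rw [curvature_eq (hd Up hUp p hp) (hd Uk hUk p hp) one_ne_zero, hE, hF] at hC
    rw [curvature_eq (hd Up hUp p hp) (hd Uk hUk p hp) hlam, hE, hF]
    simpa only [smul_zero, zero_add] using hC
end
end

section
/- Let Ω ⊆ ℝ² be open, let U_p, U_k : Ω → M₂(ℂ) be smooth, and let F̂ : Ω × (ℂ∖{0}) → GL₂(ℂ) be a smooth map satisfying ∂_xF̂(p,λ) = F̂(p,λ)·A_λ(p) and ∂_yF̂(p,λ) = F̂(p,λ)·B_λ(p) for all (p,λ) ∈ Ω × (ℂ∖{0}). Define F := F̂(·,1) and the Sym map f : Ω → M₂(ℂ) by f(p) := i·(∂F̂/∂λ)(p,1)·F̂(p,1)⁻¹. Then on Ω one has ∂_x f = i·F·(U_p + U_pᴴ)·F⁻¹ and ∂_y f = F·(U_pᴴ − U_p)·F⁻¹.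 -/
noncomputable section

open Matrix

attribute [local instance] Matrix.normedAddCommGroup Matrix.normedSpace

/-- Multiplication of `2×2` complex matrices as a continuous real-bilinear map. -/
def mulCLM : M2 →L[ℝ] M2 →L[ℝ] M2 :=
  LinearMap.toContinuousLinearMap
    ((LinearMap.toContinuousLinearMap (𝕜 := ℝ) (E := M2) (F' := M2)).toLinearMap ∘ₗ
      LinearMap.mul ℝ M2)

lemma DifferentiableAt.matrix_mul {E : Type*} [NormedAddCommGroup E] [NormedSpace ℝ E]
    {X Y : E → M2} {p : E} (hX : DifferentiableAt ℝ X p) (hY : DifferentiableAt ℝ Y p) :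
    DifferentiableAt ℝ (fun q => X q * Y q) p :=
  (mulCLM.hasFDerivAt_of_bilinear hX.hasFDerivAt hY.hasFDerivAt).differentiableAt

lemma fderiv_matrix_mul_apply {E : Type*} [NormedAddCommGroup E] [NormedSpace ℝ E]
    {X Y : E → M2} {p : E} (hX : DifferentiableAt ℝ X p) (hY : DifferentiableAt ℝ Y p) (v : E) :
    fderiv ℝ (fun q => X q * Y q) p v = fderiv ℝ X p v * Y p + X p * fderiv ℝ Y p v := by
  have h := (mulCLM.hasFDerivAt_of_bilinear hX.hasFDerivAt hY.hasFDerivAt).fderiv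
  exact (congrArg (fun L => L v) h).trans (add_comm _ _)

lemma DifferentiableAt.matrix_inv {E : Type*} [NormedAddCommGroup E] [NormedSpace ℝ E]
    {X : E → M2} {p : E} (hX : DifferentiableAt ℝ X p) (hu : IsUnit (X p)) :
    DifferentiableAt ℝ (fun q => (X q)⁻¹) p := by
  have he : ∀ i j, DifferentiableAt ℝ (fun q => X q i j) p := fun i j =>
    differentiableAt_pi.1 (differentiableAt_pi.1 hX i) j
  have hdet : (X p).det ≠ 0 := ((Matrix.isUnit_iff_isUnit_det _).1 hu).ne_zero
  rw [Matrix.det_fin_two] at hdet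
  simp only [Matrix.inv_def, Matrix.adjugate_fin_two, Matrix.det_fin_two, Ring.inverse_eq_inv']
  have hd : DifferentiableAt ℝ (fun q => (X q 0 0 * X q 1 1 - X q 0 1 * X q 1 0)⁻¹) p :=
    (((he 0 0).mul (he 1 1)).sub ((he 0 1).mul (he 1 0))).fun_inv hdet
  refine differentiableAt_pi.2 fun i => differentiableAt_pi.2 fun j => ?_
  fin_cases i <;> fin_cases j
  · exact hd.mul (he 1 1)
  · exact hd.mul (he 0 1).neg
  · exact hd.mul (he 1 0).neg
  · exact hd.mul (he 0 0)

/-- A complex derivative as the real derivative along the real direction `1`. -/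
lemma HasDerivAt.fderiv_real_apply_one {X : ℂ → M2} {X' : M2} {z : ℂ} (h : HasDerivAt X X' z) :
    DifferentiableAt ℝ X z ∧ fderiv ℝ X z 1 = X' := by
  have h' := h.hasFDerivAt.restrictScalars ℝ
  exact ⟨h'.differentiableAt, (congrArg (fun L => L 1) h'.fderiv).trans (one_smul ℂ X')⟩

/-- Directional derivative of the Sym map of an extended frame whose logarithmic derivative in the
direction `v` is `C`. -/
lemma fderiv_sym_apply {Ω : Set (ℝ × ℝ)} (hΩ : IsOpen Ω) {Fh : ℝ × ℝ → ℂ → M2}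
    (hsmooth : ContDiffOn ℝ (⊤ : ℕ∞) (fun q : (ℝ × ℝ) × ℂ => Fh q.1 q.2) (Ω ×ˢ {(0 : ℂ)}ᶜ))
    (hdiff : ∀ p ∈ Ω, DifferentiableAt ℂ (Fh p) 1)
    (hinv : ∀ p ∈ Ω, IsUnit (Fh p 1)) {p : ℝ × ℝ} (hp : p ∈ Ω) (v : ℝ × ℝ)
    {C : ℂ → M2} {C' : M2} (hC : HasDerivAt C C' 1)
    (hv : ∀ lam : ℂ, lam ≠ 0 → fderiv ℝ (fun q => Fh q lam) p v = Fh p lam * C lam) :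
    fderiv ℝ (fun q => Complex.I • (deriv (Fh q) 1 * (Fh q 1)⁻¹)) p v
      = Complex.I • (Fh p 1 * C' * (Fh p 1)⁻¹) := by
  set G : (ℝ × ℝ) × ℂ → M2 := fun q => Fh q.1 q.2
  have hopen : IsOpen (Ω ×ˢ ({(0 : ℂ)}ᶜ : Set ℂ)) := hΩ.prod isOpen_compl_singleton
  have hcd : ∀ q ∈ Ω, ∀ lam : ℂ, lam ≠ 0 → ContDiffAt ℝ (⊤ : ℕ∞) G (q, lam) :=
    fun q hq lam hl => hsmooth.contDiffAt (hopen.mem_nhds ⟨hq, hl⟩)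
  have hGd : ∀ q ∈ Ω, ∀ lam : ℂ, lam ≠ 0 → DifferentiableAt ℝ G (q, lam) :=
    fun q hq lam hl => (hcd q hq lam hl).differentiableAt (by simp)
  have hleft : ∀ (q : ℝ × ℝ) (lam : ℂ),
      HasFDerivAt (fun q : ℝ × ℝ => (q, lam)) (ContinuousLinearMap.inl ℝ (ℝ × ℝ) ℂ) q :=
    fun q lam => hasFDerivAt_prodMk_left q lam
  have hright : ∀ (q : ℝ × ℝ) (lam : ℂ),
      HasFDerivAt (fun lam : ℂ => (q, lam)) (ContinuousLinearMap.inr ℝ (ℝ × ℝ) ℂ) lam :=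
    fun q lam => hasFDerivAt_prodMk_right q lam
  have hΦ : DifferentiableAt ℝ (fderiv ℝ G) (p, 1) :=
    ((hcd p hp 1 one_ne_zero).fderiv_right (m := 1) (by norm_cast)).differentiableAt
      one_ne_zero
  have hsymm : IsSymmSndFDerivAt ℝ G (p, 1) :=
    (hcd p hp 1 one_ne_zero).isSymmSndFDerivAt (by
      rw [minSmoothness_of_isRCLikeNormedField]
      exact WithTop.coe_le_coe.2 (le_top : (2 : ℕ∞) ≤ ⊤))
  have hnear : ∀ᶠ q in nhds p, q ∈ Ω := hΩ.mem_nhds hp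
  -- the `λ`-derivative as a directional derivative of the joint map
  have hlam : ∀ q ∈ Ω, deriv (Fh q) 1 = fderiv ℝ G (q, 1) (0, 1) := by
    intro q hq
    refine (hdiff q hq).hasDerivAt.fderiv_real_apply_one.2.symm.trans ?_
    have h := (hGd q hq 1 one_ne_zero).hasFDerivAt.comp (1 : ℂ) (hright q 1)
    exact congrArg (fun L => L 1) h.fderiv
  have hW : HasFDerivAt (fun q => deriv (Fh q) 1)
      ((ContinuousLinearMap.apply ℝ M2 ((0, 1) : (ℝ × ℝ) × ℂ)).comp
        ((fderiv ℝ (fderiv ℝ G) (p, 1)).comp (ContinuousLinearMap.inl ℝ (ℝ × ℝ) ℂ))) p := by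
    have h := (ContinuousLinearMap.apply ℝ M2 ((0, 1) : (ℝ × ℝ) × ℂ)).hasFDerivAt.comp p
      (hΦ.hasFDerivAt.comp p (hleft p 1))
    refine h.congr_of_eventuallyEq ?_
    filter_upwards [hnear] with q hq
    exact hlam q hq
  have hmixed : fderiv ℝ (fun q => deriv (Fh q) 1) p v
      = deriv (Fh p) 1 * C 1 + Fh p 1 * C' := by
    obtain ⟨hC1, hC2⟩ := hC.fderiv_real_apply_one
    obtain ⟨hF1, hF2⟩ := (hdiff p hp).hasDerivAt.fderiv_real_apply_one
    have h := (ContinuousLinearMap.apply ℝ M2 ((v, 0) : (ℝ × ℝ) × ℂ)).hasFDerivAt.comp (1 : ℂ)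
      (hΦ.hasFDerivAt.comp (1 : ℂ) (hright p 1))
    have heq : (fun lam => Fh p lam * C lam) =ᶠ[nhds 1]
        fun lam : ℂ => fderiv ℝ G (p, lam) (v, 0) := by
      filter_upwards [isOpen_ne.mem_nhds (one_ne_zero : (1 : ℂ) ≠ 0)] with lam hl
      rw [← hv lam hl]
      have h := (hGd p hp lam hl).hasFDerivAt.comp p (hleft p lam)
      exact congrArg (fun L => L v) h.fderiv
    have h2 := congrArg (fun L => L 1) (h.congr_of_eventuallyEq heq).fderiv
    have h3 := fderiv_matrix_mul_apply hF1 hC1 1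
    rw [hF2, hC2] at h3
    exact (congrArg (fun L => L v) hW.fderiv).trans
      (((hsymm (v, 0) (0, 1)).trans h2.symm).trans h3)
  have hF : DifferentiableAt ℝ (fun q => Fh q 1) p := by
    have h := (hGd p hp 1 one_ne_zero).hasFDerivAt.comp p (hleft p 1)
    exact h.differentiableAt
  have hf : DifferentiableAt ℝ (fun q => Complex.I • (deriv (Fh q) 1 * (Fh q 1)⁻¹)) p :=
    (hW.differentiableAt.matrix_mul (hF.matrix_inv (hinv p hp))).const_smul Complex.I
  have hdet : ∀ q ∈ Ω, IsUnit (Fh q 1).det := fun q hq =>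
    (Matrix.isUnit_iff_isUnit_det _).1 (hinv q hq)
  have hprod : (fun q => Complex.I • (deriv (Fh q) 1 * (Fh q 1)⁻¹) * Fh q 1) =ᶠ[nhds p]
      fun q => Complex.I • deriv (Fh q) 1 := by
    filter_upwards [hnear] with q hq
    rw [smul_mul_assoc, Matrix.nonsing_inv_mul_cancel_right _ _ (hdet q hq)]
  have h1 := fderiv_matrix_mul_apply hf hF v
  have hsmul : fderiv ℝ (fun q => Complex.I • deriv (Fh q) 1) p v
      = Complex.I • fderiv ℝ (fun q => deriv (Fh q) 1) p v :=
    congrArg (fun L => L v) (hW.differentiableAt.hasFDerivAt.const_smul Complex.I).fderiv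
  rw [hprod.fderiv_eq, hv 1 one_ne_zero, hsmul, hmixed, smul_mul_assoc, ← mul_assoc,
    Matrix.nonsing_inv_mul_cancel_right _ _ (hdet p hp), smul_add, add_comm] at h1
  have h2 := add_right_cancel h1
  rw [← Matrix.mul_nonsing_inv_cancel_right _ (fderiv ℝ _ p v) (hdet p hp), ← h2,
    smul_mul_assoc]

/-- derivatives of the Sym formula
`f(p) = i·(∂F̂/∂λ)(p,1)·F̂(p,1)⁻¹` for an extended frame `F̂`. -/
theorem stmt11 (Ω : Set (ℝ × ℝ)) (hΩ : IsOpen Ω) (Up Uk : ℝ × ℝ → M2)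
    (hUp : ContDiffOn ℝ (⊤ : ℕ∞) Up Ω) (hUk : ContDiffOn ℝ (⊤ : ℕ∞) Uk Ω)
    (Fh : ℝ × ℝ → ℂ → M2)
    (hsmooth : ContDiffOn ℝ (⊤ : ℕ∞) (fun q : (ℝ × ℝ) × ℂ => Fh q.1 q.2) (Ω ×ˢ {(0 : ℂ)}ᶜ))
    (hdiff : ∀ p ∈ Ω, DifferentiableAt ℂ (Fh p) 1)
    (hinv : ∀ p ∈ Ω, ∀ lam : ℂ, lam ≠ 0 → IsUnit (Fh p lam))
    (hx : ∀ p ∈ Ω, ∀ lam : ℂ, lam ≠ 0 →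
      pxM (fun q => Fh q lam) p = Fh p lam * Amap Up Uk lam p)
    (hy : ∀ p ∈ Ω, ∀ lam : ℂ, lam ≠ 0 →
      pyM (fun q => Fh q lam) p = Fh p lam * Bmap Up Uk lam p)
    (F : ℝ × ℝ → M2) (hF : ∀ p, F p = Fh p 1)
    (f : ℝ × ℝ → M2)
    (hf : ∀ p, f p = Complex.I • (deriv (fun lam => Fh p lam) 1 * (F p)⁻¹)) :
    ∀ p ∈ Ω,
      pxM f p = Complex.I • (F p * (Up p + (Up p)ᴴ) * (F p)⁻¹) ∧
      pyM f p = F p * ((Up p)ᴴ - Up p) * (F p)⁻¹ := by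
  obtain rfl : F = fun p => Fh p 1 := funext hF
  obtain rfl : f = fun p => Complex.I • (deriv (Fh p) 1 * (Fh p 1)⁻¹) := funext hf
  intro p hp
  have hid : HasDerivAt (fun lam : ℂ => lam • Up p) (Up p) 1 := by
    have h := (hasDerivAt_id (1 : ℂ)).smul_const (Up p)
    rw [one_smul] at h
    exact h
  have hinvd : HasDerivAt (fun lam : ℂ => lam⁻¹ • (Up p)ᴴ) (-(Up p)ᴴ) 1 := by
    have h := (hasDerivAt_inv (one_ne_zero : (1 : ℂ) ≠ 0)).smul_const (Up p)ᴴ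
    rw [one_pow, inv_one, neg_one_smul] at h
    exact h
  have hA : HasDerivAt (fun lam => Amap Up Uk lam p) (Up p + (Up p)ᴴ) 1 := by
    have h := ((hid.add_const (Uk p)).sub_const (Uk p)ᴴ).sub hinvd
    rw [sub_neg_eq_add] at h
    exact h
  have hB : HasDerivAt (fun lam => Bmap Up Uk lam p) (Complex.I • (Up p - (Up p)ᴴ)) 1 := by
    have h := (((hid.add_const (Uk p)).add_const (Uk p)ᴴ).add hinvd).const_smul Complex.I
    rw [← sub_eq_add_neg] at h
    exact h
  have hu : ∀ q ∈ Ω, IsUnit (Fh q 1) := fun q hq => hinv q hq 1 one_ne_zero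
  refine ⟨fderiv_sym_apply hΩ hsmooth hdiff hu hp _ hA (hx p hp), ?_⟩
  refine (fderiv_sym_apply hΩ hsmooth hdiff hu hp _ hB (hy p hp)).trans ?_
  rw [mul_smul_comm, smul_mul_assoc, smul_smul, Complex.I_mul_I, neg_one_smul, ← neg_mul,
    ← mul_neg, neg_sub]
end
end

section
/- Let J ⊆ ℝ be an open interval and Ω ⊆ ℝ² open with J × {0} ⊆ Ω. Let a, b, c, d : Ω → ℝ be smooth with a(x,0) = 0 for all x ∈ J. Suppose that U_p := (1/2)·(i·a·e₁ + (−1 + i·b)·e₂) and U_k := (1/2)·(c + i·d)·e₃ satisfy the harmonic map equations on Ω. Then for every x ∈ J: d(x,0) = −b(x,0)·c(x,0) and (∂a/∂y)(x,0) = c(x,0)·(1 + b(x,0)²). In particular, the singular curve of the associated spherical frontal is non-degenerate at x₀ if and only if c(x₀,0) ≠ 0. -/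
noncomputable section

open Matrix

attribute [local instance] Matrix.normedAddCommGroup Matrix.normedSpace

/-- `e₁ = (1/2)[[0,−i],[−i,0]]`. -/
def e1 : M2 := (2 : ℂ)⁻¹ • !![0, -Complex.I; -Complex.I, 0]

/-- `e₂ = (1/2)[[0,1],[−1,0]]`. -/
def e2 : M2 := (2 : ℂ)⁻¹ • !![0, 1; -1, 0]

/-- `e₃ = (1/2)[[i,0],[0,−i]]`. -/
def e3 : M2 := (2 : ℂ)⁻¹ • !![Complex.I, 0; 0, -Complex.I]

/-- Partial derivative of a scalar function in the x direction. -/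
def pxR (g : ℝ × ℝ → ℝ) (p : ℝ × ℝ) : ℝ := fderiv ℝ g p (1, 0)

/-- Partial derivative of a scalar function in the y direction. -/
def pyR (g : ℝ × ℝ → ℝ) (p : ℝ × ℝ) : ℝ := fderiv ℝ g p (0, 1)

/-- The off-diagonal entries of the first harmonic map equation, for `U_p` and `U_k` as in the
singular geometric Cauchy problem, express the gradient of `a` algebraically in `b`, `c`, `d`. -/
lemma gradient_of_dzbar_eq_zero (a b c d : ℝ × ℝ → ℝ) (p : ℝ × ℝ)
    (ha : DifferentiableAt ℝ a p) (hb : DifferentiableAt ℝ b p)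
    (h : dzbar
        (fun p => (2 : ℂ)⁻¹ •
          ((Complex.I * (a p : ℂ)) • e1 + (-1 + Complex.I * (b p : ℂ)) • e2)) p
      - brk (((2 : ℂ)⁻¹ • (((c p : ℂ) + Complex.I * (d p : ℂ)) • e3))ᴴ)
        ((2 : ℂ)⁻¹ •
          ((Complex.I * (a p : ℂ)) • e1 + (-1 + Complex.I * (b p : ℂ)) • e2)) = 0) :
    pxR a p = c p * b p + d p ∧ pyR a p = c p - d p * b p := by
  have hU : (fun p => (2 : ℂ)⁻¹ •
        ((Complex.I * (a p : ℂ)) • e1 + (-1 + Complex.I * (b p : ℂ)) • e2))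
      = fun p => (a p • ((2 : ℂ)⁻¹ • Complex.I • e1) + b p • ((2 : ℂ)⁻¹ • Complex.I • e2))
        + -((2 : ℂ)⁻¹ • e2) := by
    funext q
    ext i j
    simp only [Matrix.smul_apply, Matrix.add_apply, Matrix.neg_apply, smul_eq_mul,
      Complex.real_smul]
    ring
  have hfd : HasFDerivAt (fun p => (2 : ℂ)⁻¹ •
        ((Complex.I * (a p : ℂ)) • e1 + (-1 + Complex.I * (b p : ℂ)) • e2))
      ((fderiv ℝ a p).smulRight ((2 : ℂ)⁻¹ • Complex.I • e1)
        + (fderiv ℝ b p).smulRight ((2 : ℂ)⁻¹ • Complex.I • e2)) p := by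
    rw [hU]
    exact ((ha.hasFDerivAt.smul_const _).add (hb.hasFDerivAt.smul_const _)).add_const _
  have hx : pxM (fun p => (2 : ℂ)⁻¹ •
        ((Complex.I * (a p : ℂ)) • e1 + (-1 + Complex.I * (b p : ℂ)) • e2)) p
      = pxR a p • ((2 : ℂ)⁻¹ • Complex.I • e1) + pxR b p • ((2 : ℂ)⁻¹ • Complex.I • e2) := by
    rw [pxM, hfd.fderiv]
    rfl
  have hy : pyM (fun p => (2 : ℂ)⁻¹ •
        ((Complex.I * (a p : ℂ)) • e1 + (-1 + Complex.I * (b p : ℂ)) • e2)) p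
      = pyR a p • ((2 : ℂ)⁻¹ • Complex.I • e1) + pyR b p • ((2 : ℂ)⁻¹ • Complex.I • e2) := by
    rw [pyM, hfd.fderiv]
    rfl
  rw [dzbar, hx, hy] at h
  have h01 := congrFun (congrFun h 0) 1
  have h10 := congrFun (congrFun h 1) 0
  simp only [brk, Matrix.sub_apply, Matrix.mul_apply, Fin.sum_univ_two,
    Matrix.conjTranspose_apply] at h01 h10
  simp [e1, e2, e3, Complex.ext_iff] at h01 h10
  obtain ⟨hr, hi⟩ := h01
  obtain ⟨hr', hi'⟩ := h10
  constructor <;> linarith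

/-- along the singular curve of the general singular geometric Cauchy problem
with `U_p = (1/2)(i·a·e₁ + (−1 + i·b)e₂)`, `U_k = (1/2)(c + id)e₃`, `a(x,0) = 0`, one has
`d(x,0) = −b(x,0)c(x,0)` and `a_y(x,0) = c(x,0)(1 + b(x,0)²)`; in particular the singular
curve is non-degenerate at `x₀` iff `c(x₀,0) ≠ 0`. -/
theorem stmt14 (J : Set ℝ) (hJopen : IsOpen J) (hJint : J.OrdConnected)
    (Ω : Set (ℝ × ℝ)) (hΩ : IsOpen Ω) (hJΩ : ∀ x ∈ J, ((x, (0 : ℝ)) ∈ Ω))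
    (a b c d : ℝ × ℝ → ℝ)
    (ha : ContDiffOn ℝ (⊤ : ℕ∞) a Ω) (hb : ContDiffOn ℝ (⊤ : ℕ∞) b Ω)
    (hc : ContDiffOn ℝ (⊤ : ℕ∞) c Ω) (hd : ContDiffOn ℝ (⊤ : ℕ∞) d Ω)
    (ha0 : ∀ x ∈ J, a (x, 0) = 0)
    (hharm : HarmonicEqs
      (fun p => (2 : ℂ)⁻¹ • ((Complex.I * (a p : ℂ)) • e1 + (-1 + Complex.I * (b p : ℂ)) • e2))
      (fun p => (2 : ℂ)⁻¹ • (((c p : ℂ) + Complex.I * (d p : ℂ)) • e3)) Ω) :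
    ∀ x ∈ J,
      d (x, 0) = -(b (x, 0) * c (x, 0)) ∧
      pyR a (x, 0) = c (x, 0) * (1 + b (x, 0) ^ 2) ∧
      (fderiv ℝ a (x, 0) ≠ 0 ↔ c (x, 0) ≠ 0) := by
  intro x hx
  have hnhds : Ω ∈ nhds (x, (0 : ℝ)) := hΩ.mem_nhds (hJΩ x hx)
  have ha' : DifferentiableAt ℝ a (x, 0) := (ha.contDiffAt hnhds).differentiableAt (by simp)
  have hb' : DifferentiableAt ℝ b (x, 0) := (hb.contDiffAt hnhds).differentiableAt (by simp)
  obtain ⟨hax, hay⟩ := gradient_of_dzbar_eq_zero a b c d (x, 0) ha' hb' (hharm _ (hJΩ x hx)).1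
  have hax0 : pxR a (x, 0) = 0 := by
    have hline : HasDerivAt (fun t : ℝ => (t, (0 : ℝ))) (1, 0) x :=
      (hasDerivAt_id x).prodMk (hasDerivAt_const x 0)
    have hcomp : HasDerivAt (fun t : ℝ => a (t, 0)) (pxR a (x, 0)) x :=
      HasFDerivAt.comp_hasDerivAt x ha'.hasFDerivAt hline
    have hzero : (fun t : ℝ => a (t, 0)) =ᶠ[nhds x] fun _ => 0 := by
      filter_upwards [hJopen.mem_nhds hx] with t ht using ha0 t ht
    exact hcomp.unique ((hasDerivAt_const x (0 : ℝ)).congr_of_eventuallyEq hzero)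
  have hd0 : d (x, 0) = -(b (x, 0) * c (x, 0)) := by linarith
  have hay0 : pyR a (x, 0) = c (x, 0) * (1 + b (x, 0) ^ 2) := by
    rw [hay, hd0]
    ring
  have hpos : 1 + b (x, 0) ^ 2 ≠ 0 := by positivity
  refine ⟨hd0, hay0, not_congr ⟨fun h => ?_, fun h => ?_⟩⟩
  · rw [pyR, h] at hay0
    simpa [hpos] using hay0.symm
  · ext
    · simpa [pxR] using hax0
    · simpa [pyR, h] using hay0
end
end

section
/- Define f₀ : ℝ → ℝ³ by f₀(s) = (cos s, sin s, 0) and N₀ : ℝ → ℝ³ by N₀(s) = cos(s/2)·(0,0,1) + sin(s/2)·f₀(s). Then for all s ∈ ℝ: ‖N₀(s)‖ = 1, ⟨f₀′(s), N₀(s)⟩ = 0, N₀(s + 2π) = −N₀(s) while f₀(s + 2π) = f₀(s), and the geometric Cauchy data functions satisfy κ_n(s) := ⟨f₀″(s), N₀(s)⟩ = −sin(s/2), κ_g(s) := ⟨f₀″(s), N₀(s) × f₀′(s)⟩ = cos(s/2), and μ(s) := ⟨f₀′(s) × N₀(s), N₀′(s)⟩ = 1/2. -/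
noncomputable section

open Real

/-- Differentiation of a curve in `ℝ³` given by three coordinate functions. -/
theorem hasDerivAt_vec3 {f g h : ℝ → ℝ} {f' g' h' s : ℝ} (hf : HasDerivAt f f' s)
    (hg : HasDerivAt g g' s) (hh : HasDerivAt h h' s) :
    HasDerivAt (fun t => ![f t, g t, h t]) ![f', g', h'] s := by
  rw [hasDerivAt_pi]
  intro i
  fin_cases i
  · exact hf
  · exact hg
  · exact hh

/-- the geometric Cauchy data of the non-orientable spherical cylinder
example: `f₀(s) = (cos s, sin s, 0)`, `N₀(s) = cos(s/2)(0,0,1) + sin(s/2) f₀(s)`. -/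
theorem stmt16 (f₀ N₀ : ℝ → Fin 3 → ℝ)
    (hf : ∀ s, f₀ s = ![Real.cos s, Real.sin s, 0])
    (hN : ∀ s, N₀ s = Real.cos (s / 2) • ![(0:ℝ), 0, 1] + Real.sin (s / 2) • f₀ s) :
    ∀ s : ℝ,
      norm3 (N₀ s) = 1 ∧
      dot3 (deriv f₀ s) (N₀ s) = 0 ∧
      N₀ (s + 2 * Real.pi) = -N₀ s ∧
      f₀ (s + 2 * Real.pi) = f₀ s ∧
      dot3 (deriv (deriv f₀) s) (N₀ s) = -Real.sin (s / 2) ∧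
      dot3 (deriv (deriv f₀) s) (cross3 (N₀ s) (deriv f₀ s)) = Real.cos (s / 2) ∧
      dot3 (cross3 (deriv f₀ s) (N₀ s)) (deriv N₀ s) = 1 / 2 := by
  obtain rfl : f₀ = fun s => ![Real.cos s, Real.sin s, 0] := funext hf
  obtain rfl : N₀ = fun s =>
      ![Real.sin (s / 2) * Real.cos s, Real.sin (s / 2) * Real.sin s, Real.cos (s / 2)] := by
    funext s
    rw [hN]
    ext i
    fin_cases i <;> simp
  have hd₁ : deriv (fun s : ℝ => ![Real.cos s, Real.sin s, 0]) =
      fun s => ![-Real.sin s, Real.cos s, 0] := funext fun s =>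
    (hasDerivAt_vec3 (Real.hasDerivAt_cos s) (Real.hasDerivAt_sin s) (hasDerivAt_const s 0)).deriv
  have hd₂ : deriv (fun s : ℝ => ![-Real.sin s, Real.cos s, 0]) =
      fun s => ![-Real.cos s, -Real.sin s, 0] := funext fun s =>
    (hasDerivAt_vec3 (Real.hasDerivAt_sin s).neg (Real.hasDerivAt_cos s)
      (hasDerivAt_const s 0)).deriv
  intro s
  have hhalf : HasDerivAt (fun t : ℝ => t / 2) (1 / 2) s := (hasDerivAt_id s).div_const 2
  have hdN := (hasDerivAt_vec3 (hhalf.sin.mul (Real.hasDerivAt_cos s))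
    (hhalf.sin.mul (Real.hasDerivAt_sin s)) hhalf.cos).deriv
  simp only [Pi.mul_apply] at hdN
  have hs := Real.sin_sq_add_cos_sq s
  have hh := Real.sin_sq_add_cos_sq (s / 2)
  have hadd : (s + 2 * Real.pi) / 2 = s / 2 + Real.pi := by ring
  refine ⟨?_, ?_, ?_, ?_, ?_, ?_, ?_⟩
  · rw [norm3, Real.sqrt_eq_one]
    simp [dot3]
    linear_combination Real.sin (s / 2) ^ 2 * hs + hh
  · simp [hd₁, dot3]
    ring
  · ext i
    fin_cases i <;> simp [hadd, Real.sin_add_pi, Real.cos_add_pi]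
  · simp
  · simp [hd₁, hd₂, dot3]
    linear_combination -Real.sin (s / 2) * hs
  · simp [hd₁, hd₂, dot3, cross3]
    linear_combination Real.cos (s / 2) * hs
  · rw [hdN]
    simp [hd₁, dot3, cross3]
    grind
end
end
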